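/- Let u ∈ (−1, 0] and for m ∈ ℤ let v_{2m}^{(u)}(x) = (1+x²)^{−(1+u)/2} ((1+xi)/(1−xi))^m. For every ξ ≠ 0 the improper Fourier transform 𝓕v_{2m}^{(u)}(ξ) = lim_{R→∞} ∫_{−R}^{R} v_{2m}^{(u)}(x) e^{−2πixξ} dx exists, and there exist constants q'_u, q_u > 0 (depending only on u) such that for all m ∈ ℤ: q'_u (1+m²)^{−u/2} ≤ ∫_ℝ |ξ|^{−u} |𝓕v_{2m}^{(u)}(ξ)|² dξ ≤ q_u (1+m²)^{−u/2}. -/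

import Mathlib

open MeasureTheory Real Set Filter Complex
open scoped ENNReal NNReal

noncomputable section

/-- The weight-`2m` K-type vector `v_{2m}^{(u)}(x) = (1+x²)^{−(1+u)/2} ((1+xi)/(1−xi))^m`
of the principal series `P(u,+)` in the noncompact picture. -/
def vEven (u : ℂ) (m : ℤ) (x : ℝ) : ℂ :=
  ((1 + x ^ 2 : ℝ) : ℂ) ^ (-(1 + u) / 2) *
    ((1 + (x : ℂ) * Complex.I) / (1 - (x : ℂ) * Complex.I)) ^ m

/-- `z` is the improper Fourier transform of `g` at `ξ`:
`z = lim_{R→∞} ∫_{−R}^R g(x) e^{−2πixξ} dx`. -/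
def IsImpFT (g : ℝ → ℂ) (ξ : ℝ) (z : ℂ) : Prop :=
  Filter.Tendsto
    (fun R : ℝ => ∫ x in Set.Ioc (-R) R,
      g x * Complex.exp (-2 * (Real.pi : ℂ) * Complex.I * (x : ℂ) * (ξ : ℂ)))
    Filter.atTop (nhds z)

theorem continuous_fourier_of_integrable {g : ℝ → ℂ} (hg : Integrable g) :
    Continuous (FourierTransform.fourier g : ℝ → ℂ) :=
  VectorFourier.fourierIntegral_continuous continuous_fourierChar
    (by simpa using! continuous_inner) hg

open FourierTransform SchwartzMap in
/-- The `L²` Fourier transform agrees with the Fourier integral on `L¹ ∩ L²`. -/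
theorem coeFn_fourier_toLp_ae_eq {f : ℝ → ℂ} (h1 : Integrable f) (h2 : MemLp f 2) :
    (𝓕 (h2.toLp f) : Lp ℂ 2 (volume : Measure ℝ)) =ᵐ[volume] 𝓕 f := by
  have hc : Continuous (𝓕 f) := continuous_fourier_of_integrable h1
  have hL : LocallyIntegrable (𝓕 (h2.toLp f) : Lp ℂ 2 (volume : Measure ℝ)) :=
    (Lp.memLp _).locallyIntegrable (by norm_num)
  have key := ae_eq_zero_of_integral_contDiff_smul_eq_zero (μ := volume)
    (f := fun x => (𝓕 (h2.toLp f) : Lp ℂ 2 (volume : Measure ℝ)) x - 𝓕 f x)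
    (hL.sub hc.locallyIntegrable) ?_
  · filter_upwards [key] with x hx
    exact sub_eq_zero.1 hx
  intro g hg hgs
  have hg's : HasCompactSupport (fun x => (g x : ℂ)) := hgs.comp_left (g := fun t : ℝ => (t : ℂ)) rfl
  have hg' : ContDiff ℝ ((⊤ : ℕ∞) : WithTop ℕ∞) (fun x => (g x : ℂ)) :=
    Complex.ofRealCLM.contDiff.comp hg
  let G : 𝓢(ℝ, ℂ) := hg's.toSchwartzMap hg'
  have hG : ∀ x, G x = (g x : ℂ) := fun x => rfl
  have e := congrArg (fun T => T G) (Lp.fourier_toTemperedDistribution_eq (h2.toLp f))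
  simp only [TemperedDistribution.fourier_apply, Lp.toTemperedDistribution_apply] at e
  have e2 : ∫ x, (𝓕 G) x • (h2.toLp f) x = ∫ x, (𝓕 G) x • f x := by
    apply integral_congr_ae
    filter_upwards [h2.coeFn_toLp] with x hx
    rw [hx]
  have e3 : ∫ x, (𝓕 G) x • f x = ∫ x, G x • 𝓕 f x := by
    have := VectorFourier.integral_fourierIntegral_smul_eq_flip (L := innerₗ ℝ)
      (μ := volume) (ν := volume) continuous_fourierChar continuous_inner G.integrable h1
    simpa using! this
  have i1 : Integrable (fun x => g x • (𝓕 (h2.toLp f) : Lp ℂ 2 (volume : Measure ℝ)) x) :=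
    hL.integrable_smul_left_of_hasCompactSupport hg.continuous hgs
  have i2 : Integrable (fun x => g x • 𝓕 f x) :=
    hc.locallyIntegrable.integrable_smul_left_of_hasCompactSupport hg.continuous hgs
  simp only [smul_sub]
  rw [integral_sub i1 i2, sub_eq_zero]
  rw [e2, e3] at e
  simpa [hG] using e.symm

open FourierTransform in
/-- **Plancherel's theorem** for functions in `L¹ ∩ L²`. -/
theorem lintegral_enorm_fourier_sq {f : ℝ → ℂ} (h1 : Integrable f) (h2 : MemLp f 2) :
    ∫⁻ ξ, ‖𝓕 f ξ‖ₑ ^ 2 = ∫⁻ x, ‖f x‖ₑ ^ 2 := by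
  have h := Lp.norm_fourier_eq (h2.toLp f)
  rw [Lp.norm_def, Lp.norm_def, ENNReal.toReal_eq_toReal_iff' (Lp.eLpNorm_ne_top _)
    (Lp.eLpNorm_ne_top _), eLpNorm_congr_ae (coeFn_fourier_toLp_ae_eq h1 h2),
    eLpNorm_congr_ae h2.coeFn_toLp] at h
  have hs : ∀ g : ℝ → ℂ, ∫⁻ x, ‖g x‖ₑ ^ 2 = eLpNorm g 2 volume ^ 2 := fun g => by
    have := eLpNorm_nnreal_pow_eq_lintegral (f := g) (μ := volume) (p := 2) two_ne_zero
    norm_num at this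
    exact this.symm
  rw [hs, hs, h]

open FourierTransform in
/-- For a function with integrable derivative `g`, this is its improper Fourier transform. -/
def derivFT (g : ℝ → ℂ) (ξ : ℝ) : ℂ := 𝓕 g ξ / (2 * π * I * ξ)

theorem two_pi_I_mul_ne_zero {ξ : ℝ} (hξ : ξ ≠ 0) : (2 * π * I * ξ : ℂ) ≠ 0 := by
  simp [hξ, Real.pi_ne_zero]

open FourierTransform in
theorem isImpFT_derivFT {f g : ℝ → ℂ} (hd : ∀ x, HasDerivAt f (g x) x) (hg : Integrable g)
    (ht : Tendsto f atTop (nhds 0)) (hb : Tendsto f atBot (nhds 0)) {ξ : ℝ} (hξ : ξ ≠ 0) :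
    IsImpFT f ξ (derivFT g ξ) := by
  set c : ℂ := -2 * π * I * ξ with hc
  have hc0 : c ≠ 0 := by simp [hc, hξ, Real.pi_ne_zero]
  have hE : ∀ x : ℝ, HasDerivAt (fun x : ℝ => cexp (c * x) / c) (cexp (c * x)) x := fun x => by
    have h1 : HasDerivAt (fun x : ℝ => c * (x : ℂ)) c x := by
      simpa using (Complex.ofRealCLM.hasDerivAt (x := x)).const_mul c
    have h2 := h1.cexp.div_const c
    rwa [mul_div_cancel_right₀ _ hc0] at h2
  have hEc : Continuous (fun x : ℝ => cexp (c * x)) := by fun_prop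
  have hEn : ∀ x : ℝ, ‖cexp (c * x)‖ = 1 := fun x => by
    rw [Complex.norm_exp]; simp [hc]
  have hgE : Integrable (fun x => g x * (cexp (c * x) / c)) := by
    have := (hg.mul_const c⁻¹).bdd_mul hEc.aestronglyMeasurable (c := 1)
      (Eventually.of_forall fun x => (hEn x).le)
    refine this.congr (Eventually.of_forall fun x => ?_)
    simp only; ring
  have hbd : ∀ l : Filter ℝ, Tendsto f l (nhds 0) →
      Tendsto (fun x => f x * (cexp (c * x) / c)) l (nhds 0) := fun l hl => by
    rw [tendsto_zero_iff_norm_tendsto_zero] at hl ⊢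
    have : ∀ x, ‖f x * (cexp (c * x) / c)‖ = ‖f x‖ * ‖c‖⁻¹ := fun x => by
      rw [norm_mul, norm_div, hEn, one_div]
    simp_rw [this]
    simpa using hl.mul_const ‖c‖⁻¹
  have hval : derivFT g ξ = 0 - 0 - ∫ x, g x * (cexp (c * x) / c) := by
    rw [derivFT, Real.fourier_real_eq_integral_exp_smul, sub_zero, zero_sub, ← integral_neg,
      ← integral_div]
    congr 1; ext x
    have h0 := two_pi_I_mul_ne_zero hξ
    have e1 : cexp (↑(-2 * π * x * ξ) * I) = cexp (c * x) := by
      rw [hc]; congr 1; push_cast; ring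
    rw [e1, smul_eq_mul, hc]
    have : (-2 * π * I * ξ : ℂ) = -(2 * π * I * ξ) := by ring
    rw [this]
    field_simp
  rw [IsImpFT, hval]
  have hlim := (((hbd _ ht).sub ((hbd _ hb).comp tendsto_neg_atTop_atBot)).sub
    (intervalIntegral_tendsto_integral hgE tendsto_neg_atTop_atBot tendsto_id))
  refine hlim.congr' ?_
  filter_upwards [eventually_ge_atTop (0 : ℝ)] with R hR
  rw [← intervalIntegral.integral_of_le (by linarith)]
  have hib := intervalIntegral.integral_mul_deriv_eq_deriv_mul (a := -R) (b := R)
    (fun x _ => hd x) (fun x _ => hE x) hg.intervalIntegrable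
    (hEc.intervalIntegrable _ _)
  simp only [Function.comp_apply, id]
  rw [← hib]
  congr 1; ext x
  rw [hc]; congr 2; ring

theorem integrable_translate_sub {f g : ℝ → ℂ} (hd : ∀ x, HasDerivAt f (g x) x)
    (hg : Integrable g) (h : ℝ) : Integrable (fun x => f (x + h) - f x) := by
  have hfc : Continuous f := continuous_iff_continuousAt.2 fun x => (hd x).continuousAt
  have hrep : ∀ x, f (x + h) - f x = ∫ t in (0 : ℝ)..h, g (x + t) := fun x => by
    rw [intervalIntegral.integral_comp_add_left, add_zero,
      intervalIntegral.integral_eq_sub_of_hasDerivAt (fun y _ => hd y) hg.intervalIntegrable]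
  have hg' : g = deriv f := funext fun x => (hd x).deriv.symm
  have hgm : Measurable g := hg' ▸ measurable_deriv f
  refine ⟨by fun_prop, ?_⟩
  calc ∫⁻ x, ‖f (x + h) - f x‖ₑ
      ≤ ∫⁻ x, ∫⁻ t in uIoc (0 : ℝ) h, ‖g (x + t)‖ₑ := by
        refine lintegral_mono fun x => ?_
        rw [hrep, intervalIntegral.intervalIntegral_eq_integral_uIoc]
        refine le_trans ?_ (enorm_integral_le_lintegral_enorm _)
        rw [enorm_smul]
        split_ifs <;> simp
    _ = ∫⁻ t in uIoc (0 : ℝ) h, ∫⁻ x, ‖g (x + t)‖ₑ := by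
        refine lintegral_lintegral_swap ?_
        exact ((hgm.comp (measurable_fst.add measurable_snd)).enorm).aemeasurable
    _ = ∫⁻ t in uIoc (0 : ℝ) h, ∫⁻ x, ‖g x‖ₑ := by
        simp_rw [lintegral_add_right_eq_self (fun x => ‖g x‖ₑ)]
    _ < ⊤ := by
        rw [lintegral_const]
        refine ENNReal.mul_lt_top hg.2 ?_
        simp

theorem memLp_two_translate_sub {f g : ℝ → ℂ} (hd : ∀ x, HasDerivAt f (g x) x)
    (hg : Integrable g) {C : ℝ} (hf : ∀ x, ‖f x‖ ≤ C) (h : ℝ) :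
    MemLp (fun x => f (x + h) - f x) 2 := by
  have hi := integrable_translate_sub hd hg h
  rw [memLp_two_iff_integrable_sq_norm hi.aestronglyMeasurable]
  have := hi.norm.bdd_mul hi.norm.aestronglyMeasurable (c := C + C)
    (Eventually.of_forall fun x => by
      rw [norm_norm]; exact (norm_sub_le _ _).trans (add_le_add (hf _) (hf _)))
  refine this.congr (Eventually.of_forall fun x => ?_)
  simp only [sq]

open FourierTransform in
theorem lintegral_enorm_translate_sub_sq {f g : ℝ → ℂ} (hd : ∀ x, HasDerivAt f (g x) x)
    (hg : Integrable g) {C : ℝ} (hf : ∀ x, ‖f x‖ ≤ C) (h : ℝ) :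
    ∫⁻ x, ‖f (x + h) - f x‖ₑ ^ 2 =
      ∫⁻ ξ, ‖cexp (2 * π * I * (ξ * h : ℝ)) - 1‖ₑ ^ 2 * ‖derivFT g ξ‖ₑ ^ 2 := by
  have hi := integrable_translate_sub hd hg h
  rw [← lintegral_enorm_fourier_sq hi (memLp_two_translate_sub hd hg hf h)]
  have hd' : ∀ x, HasDerivAt (fun x => f (x + h) - f x) (g (x + h) - g x) x := fun x =>
    ((hd (x + h)).comp_add_const x h).sub (hd x)
  have hder : deriv (fun x => f (x + h) - f x) = fun x => g (x + h) - g x :=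
    funext fun x => (hd' x).deriv
  have hgh : Integrable (fun x => g (x + h)) := hg.comp_add_right h
  have hF := Real.fourier_deriv hi (fun x => (hd' x).differentiableAt)
    (by rw [hder]; exact hgh.sub hg)
  rw [hder] at hF
  refine lintegral_congr_ae ?_
  filter_upwards [compl_mem_ae_iff.2 (measure_singleton (μ := volume) (0 : ℝ))] with ξ hξ
  have hξ0 : ξ ≠ 0 := hξ
  rw [← mul_pow, ← enorm_mul]
  congr 2
  have e := congrFun hF ξ
  have e1 : 𝓕 (fun x => g (x + h) - g x) ξ = (cexp (2 * π * I * (ξ * h : ℝ)) - 1) * 𝓕 g ξ := by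
    have hs : 𝓕 (fun x => g (x + h)) ξ = cexp (2 * π * I * (ξ * h : ℝ)) * 𝓕 g ξ := by
      rw [Real.fourier_real_eq_integral_exp_smul, Real.fourier_real_eq_integral_exp_smul,
        ← integral_add_right_eq_self (fun v : ℝ => cexp (↑(-2 * π * v * ξ) * I) • g v) h,
        ← integral_const_mul]
      congr 1; ext x
      rw [smul_eq_mul, smul_eq_mul, ← mul_assoc, ← Complex.exp_add]
      congr 2; push_cast; ring
    have hsub : 𝓕 (fun x => g (x + h) - g x) ξ = 𝓕 (fun x => g (x + h)) ξ - 𝓕 g ξ := by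
      simp_rw [Real.fourier_real_eq_integral_exp_smul, smul_sub]
      have hE_int : ∀ k : ℝ → ℂ, Integrable k →
          Integrable (fun v : ℝ => cexp (↑(-2 * π * v * ξ) * I) • k v) := fun k hk =>
        hk.bdd_mul (c := 1) (by fun_prop)
          (Eventually.of_forall fun x => (Complex.norm_exp_ofReal_mul_I _).le)
      exact integral_sub (hE_int _ hgh) (hE_int _ hg)
    rw [hsub, hs]; ring
  rw [e1, smul_eq_mul] at e
  rw [derivFT, mul_div_assoc', e, mul_div_cancel_left₀ _ (two_pi_I_mul_ne_zero hξ0)]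

theorem measurable_abs_rpow (p : ℝ) : Measurable fun t : ℝ => |t| ^ p := by fun_prop

theorem lintegral_comp_mul_left_eq {c : ℝ} (hc : c ≠ 0) (k : ℝ → ℝ≥0∞) :
    ∫⁻ t, k t = ENNReal.ofReal |c| * ∫⁻ t, k (c * t) := by
  have himg : (fun t : ℝ => c * t) '' univ = univ := by
    rw [image_univ]; exact (mul_left_surjective₀ hc).range_eq
  have := lintegral_image_eq_lintegral_abs_deriv_mul (s := univ) (f := fun t => c * t)
    (f' := fun _ => c) MeasurableSet.univ
    (fun x _ => (by simpa using (hasDerivAt_id x).const_mul c :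
      HasDerivAt (fun t => c * t) c x).hasDerivWithinAt)
    (mul_right_injective₀ hc).injOn k
  rw [himg] at this
  simp only [Measure.restrict_univ] at this
  rw [this, lintegral_const_mul' _ _ ENNReal.ofReal_ne_top]

theorem lintegral_rpow_mul_comp_mul_left {c : ℝ} (hc : c ≠ 0) (σ : ℝ) (k : ℝ → ℝ≥0∞) :
    ∫⁻ t, ENNReal.ofReal (|t| ^ (-1 - σ)) * k (c * t) =
      ENNReal.ofReal (|c| ^ σ) * ∫⁻ t, ENNReal.ofReal (|t| ^ (-1 - σ)) * k t := by
  have hc' : 0 < |c| := abs_pos.2 hc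
  rw [lintegral_comp_mul_left_eq hc (fun t => ENNReal.ofReal (|t| ^ (-1 - σ)) * k t), ← mul_assoc,
    ← ENNReal.ofReal_mul (by positivity), ← lintegral_const_mul' _ _ ENNReal.ofReal_ne_top]
  refine lintegral_congr fun t => ?_
  rw [← mul_assoc, ← ENNReal.ofReal_mul (by positivity), abs_mul,
    mul_rpow hc'.le (abs_nonneg t)]
  congr 2
  have : |c| ^ σ * |c| * |c| ^ (-1 - σ) = 1 := by
    nth_rw 2 [← Real.rpow_one |c|]
    rw [← rpow_add hc', ← rpow_add hc']
    have : σ + 1 + (-1 - σ) = 0 := by ring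
    rw [this, rpow_zero]
  rw [← mul_assoc, this, one_mul]

theorem lintegral_abs_eq (k : ℝ → ℝ≥0∞) : ∫⁻ t, k |t| = 2 * ∫⁻ t in Ioi 0, k t := by
  have h1 : ∫⁻ t, k |t| = (∫⁻ t in Iic 0, k |t|) + ∫⁻ t in Ioi 0, k |t| := by
    rw [← lintegral_add_compl (fun t => k |t|) (measurableSet_Iic (a := (0 : ℝ))), compl_Iic]
  have h2 : ∫⁻ t in Ioi 0, k |t| = ∫⁻ t in Ioi 0, k t :=
    setLIntegral_congr_fun measurableSet_Ioi fun t ht => by rw [abs_of_pos ht]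
  have h3 : ∫⁻ t in Iic 0, k |t| = ∫⁻ t in Ioi 0, k t := by
    rw [setLIntegral_congr Iio_ae_eq_Iic.symm]
    have himg : (fun t : ℝ => -t) '' Ioi 0 = Iio 0 := by simp
    have := lintegral_image_eq_lintegral_abs_deriv_mul (s := Ioi 0) (f := fun t => -t)
      (f' := fun _ => -1) measurableSet_Ioi (fun x _ => (hasDerivAt_neg x).hasDerivWithinAt)
      neg_injective.injOn (fun t => k |t|)
    rw [himg] at this
    rw [this, ← h2]
    simp
  rw [h1, h2, h3, two_mul]

theorem lintegral_rpow_mul_min_lt_top {a b : ℝ} (ha : 0 < a) (hab : a < b) :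
    ∫⁻ t : ℝ, ENNReal.ofReal (|t| ^ (-1 - a) * min 1 (|t| ^ b)) < ⊤ := by
  rw [lintegral_abs_eq (fun t => ENNReal.ofReal (t ^ (-1 - a) * min 1 (t ^ b)))]
  refine ENNReal.mul_lt_top (by simp) ?_
  rw [← Ioc_union_Ioi_eq_Ioi (zero_le_one' ℝ),
    lintegral_union measurableSet_Ioi (Ioc_disjoint_Ioi le_rfl)]
  refine ENNReal.add_lt_top.2 ⟨?_, ?_⟩
  · have hi : IntegrableOn (fun t : ℝ => t ^ (-1 - a + b)) (Ioc 0 1) :=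
      (intervalIntegrable_iff_integrableOn_Ioc_of_le zero_le_one).1
        (intervalIntegral.intervalIntegrable_rpow' (by linarith))
    refine lt_of_le_of_lt (setLIntegral_mono' measurableSet_Ioc fun t ht => ?_)
      hi.lintegral_lt_top
    rw [rpow_add ht.1]
    exact ENNReal.ofReal_le_ofReal (mul_le_mul_of_nonneg_left (min_le_right _ _)
      (rpow_nonneg ht.1.le _))
  · have hi : IntegrableOn (fun t : ℝ => t ^ (-1 - a)) (Ioi 1) :=
      integrableOn_Ioi_rpow_of_lt (by linarith) one_pos
    refine lt_of_le_of_lt (setLIntegral_mono' measurableSet_Ioi fun t ht => ?_)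
      hi.lintegral_lt_top
    exact ENNReal.ofReal_le_ofReal (mul_le_of_le_one_right
      (rpow_nonneg (zero_le_one.trans ht.le) _) (min_le_left _ _))

theorem measurable_derivFT {g : ℝ → ℂ} (hg : Integrable g) : Measurable (derivFT g) :=
  (continuous_fourier_of_integrable hg).measurable.div (by fun_prop)

/-- The constant relating the Gagliardo seminorm and the Fourier side. -/
def gagliardoConst (σ : ℝ) : ℝ≥0∞ :=
  ∫⁻ t, ENNReal.ofReal (|t| ^ (-1 - σ)) * ‖cexp (2 * π * I * (t : ℝ)) - 1‖ₑ ^ 2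

theorem norm_exp_two_pi_sub_one (t : ℝ) :
    ‖cexp (2 * π * I * (t : ℝ)) - 1‖ = 2 * |Real.sin (π * t)| := by
  have : (2 * π * I * (t : ℝ) : ℂ) = I * ((2 * π * t : ℝ) : ℂ) := by push_cast; ring
  rw [this, Complex.norm_exp_I_mul_ofReal_sub_one, norm_mul, Real.norm_eq_abs, Real.norm_eq_abs]
  norm_num
  congr 2; ring

theorem gagliardoConst_lt_top {σ : ℝ} (h0 : 0 < σ) (h2 : σ < 2) : gagliardoConst σ < ⊤ := by
  have hle : gagliardoConst σ ≤ ∫⁻ t : ℝ, ENNReal.ofReal (4 * π ^ 2) *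
      ENNReal.ofReal (|t| ^ (-1 - σ) * min 1 (|t| ^ (2 : ℝ))) := by
    refine lintegral_mono fun t => ?_
    rw [← ofReal_norm, ← ENNReal.ofReal_pow (norm_nonneg _), norm_exp_two_pi_sub_one,
      ← ENNReal.ofReal_mul (by positivity), ← ENNReal.ofReal_mul (by positivity), mul_left_comm]
    refine ENNReal.ofReal_le_ofReal (mul_le_mul_of_nonneg_left ?_ (by positivity))
    have hs1 : |Real.sin (π * t)| ≤ 1 := Real.abs_sin_le_one _
    have hs2 : |Real.sin (π * t)| ≤ π * |t| := by
      have := Real.abs_sin_le_abs (x := π * t)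
      rwa [abs_mul, abs_of_pos Real.pi_pos] at this
    have hpi := Real.pi_gt_three
    rw [Real.rpow_two]
    rcases min_choice (1 : ℝ) (|t| ^ 2) with h | h <;> rw [h]
    · nlinarith [abs_nonneg (Real.sin (π * t))]
    · have := pow_le_pow_left₀ (abs_nonneg _) hs2 2
      nlinarith
  refine hle.trans_lt ?_
  rw [lintegral_const_mul' _ _ ENNReal.ofReal_ne_top]
  exact ENNReal.mul_lt_top ENNReal.ofReal_lt_top (lintegral_rpow_mul_min_lt_top h0 h2)

theorem lintegral_rpow_mul_sq_sin_pos (σ : ℝ) {c r : ℝ} (hc : c ≠ 0) (hr : 0 < r) :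
    0 < ∫⁻ t in Ioo (-r) r,
      ENNReal.ofReal (|t| ^ (-1 - σ)) * ENNReal.ofReal (Real.sin (c * t) ^ 2) := by
  have hc' : 0 < |c| := abs_pos.2 hc
  have hpos : 0 < min r (π / |c|) := lt_min hr (by positivity)
  have hsub : Ioo 0 (min r (π / |c|)) ⊆ Ioo (-r) r := fun t ht =>
    ⟨by linarith [ht.1], ht.2.trans_le (min_le_left _ _)⟩
  refine lt_of_lt_of_le ?_ (lintegral_mono_set hsub)
  rw [setLIntegral_pos_iff (by fun_prop)]
  refine lt_of_lt_of_le ?_ (measure_mono (s := Ioo 0 (min r (π / |c|))) ?_)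
  · rw [Real.volume_Ioo, sub_zero]
    exact ENNReal.ofReal_pos.2 hpos
  · refine fun t ht => ⟨?_, ht⟩
    have ht2 : |c| * t < π := by
      have := ht.2.trans_le (min_le_right _ _)
      rwa [lt_div_iff₀ hc', mul_comm] at this
    have hs : Real.sin (c * t) ^ 2 = Real.sin (|c| * t) ^ 2 := by
      rcases abs_choice c with h | h <;> rw [h]
      rw [neg_mul, Real.sin_neg, neg_sq]
    have := Real.sin_pos_of_pos_of_lt_pi (mul_pos hc' ht.1) ht2
    have h1 : 0 < |t| ^ (-1 - σ) := rpow_pos_of_pos (abs_pos.2 ht.1.ne') _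
    rw [Function.mem_support, hs]
    exact mul_ne_zero (ENNReal.ofReal_pos.2 h1).ne' (ENNReal.ofReal_pos.2 (by positivity)).ne'

theorem gagliardoConst_pos (σ : ℝ) : 0 < gagliardoConst σ := by
  refine lt_of_lt_of_le (lintegral_rpow_mul_sq_sin_pos σ Real.pi_ne_zero one_pos) ?_
  refine (setLIntegral_le_lintegral _ _).trans (lintegral_mono fun t => ?_)
  simp only
  gcongr
  rw [← ofReal_norm, ← ENNReal.ofReal_pow (norm_nonneg _), norm_exp_two_pi_sub_one]
  refine ENNReal.ofReal_le_ofReal ?_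
  rw [mul_pow, sq_abs]
  nlinarith [sq_nonneg (Real.sin (π * t))]

theorem gagliardo_eq {σ : ℝ} {f g : ℝ → ℂ} (hd : ∀ x, HasDerivAt f (g x) x)
    (hg : Integrable g) {C : ℝ} (hf : ∀ x, ‖f x‖ ≤ C) :
    ∫⁻ x, ∫⁻ y, ENNReal.ofReal (|y - x| ^ (-1 - σ)) * ‖f y - f x‖ₑ ^ 2 =
      gagliardoConst σ * ∫⁻ ξ, ENNReal.ofReal (|ξ| ^ σ) * ‖derivFT g ξ‖ₑ ^ 2 := by
  have hfc : Continuous f := continuous_iff_continuousAt.2 fun x => (hd x).continuousAt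
  have hF := measurable_derivFT hg
  calc ∫⁻ x, ∫⁻ y, ENNReal.ofReal (|y - x| ^ (-1 - σ)) * ‖f y - f x‖ₑ ^ 2
      = ∫⁻ x, ∫⁻ h, ENNReal.ofReal (|h| ^ (-1 - σ)) * ‖f (x + h) - f x‖ₑ ^ 2 := by
        refine lintegral_congr fun x => ?_
        rw [← lintegral_add_left_eq_self _ x]
        simp_rw [add_sub_cancel_left]
    _ = ∫⁻ h, ∫⁻ x, ENNReal.ofReal (|h| ^ (-1 - σ)) * ‖f (x + h) - f x‖ₑ ^ 2 := by
        refine lintegral_lintegral_swap (Measurable.aemeasurable ?_)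
        simp only [Function.uncurry_def]
        fun_prop
    _ = ∫⁻ h, ∫⁻ ξ, ENNReal.ofReal (|h| ^ (-1 - σ)) *
          (‖cexp (2 * π * I * (ξ * h : ℝ)) - 1‖ₑ ^ 2 * ‖derivFT g ξ‖ₑ ^ 2) := by
        refine lintegral_congr fun h => ?_
        rw [lintegral_const_mul' _ _ ENNReal.ofReal_ne_top,
          lintegral_const_mul' _ _ ENNReal.ofReal_ne_top,
          lintegral_enorm_translate_sub_sq hd hg hf]
    _ = ∫⁻ ξ, ∫⁻ h, ENNReal.ofReal (|h| ^ (-1 - σ)) *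
          (‖cexp (2 * π * I * (ξ * h : ℝ)) - 1‖ₑ ^ 2 * ‖derivFT g ξ‖ₑ ^ 2) := by
        refine lintegral_lintegral_swap (Measurable.aemeasurable ?_)
        simp only [Function.uncurry_def]
        fun_prop
    _ = ∫⁻ ξ, gagliardoConst σ * (ENNReal.ofReal (|ξ| ^ σ) * ‖derivFT g ξ‖ₑ ^ 2) := by
        refine lintegral_congr_ae ?_
        filter_upwards [compl_mem_ae_iff.2 (measure_singleton (μ := volume) (0 : ℝ))] with ξ hξ
        simp_rw [← mul_assoc]
        rw [lintegral_mul_const' _ _ (by simp), mul_comm (gagliardoConst σ)]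
        congr 1
        exact lintegral_rpow_mul_comp_mul_left hξ σ
          (fun t => ‖cexp (2 * π * I * (t : ℝ)) - 1‖ₑ ^ 2)
    _ = _ := by rw [lintegral_const_mul _ (by fun_prop)]

theorem lintegral_eq_lintegral_tan (g : ℝ → ℝ≥0∞) :
    ∫⁻ x, g x = ∫⁻ θ in Ioo (-(π / 2)) (π / 2),
      ENNReal.ofReal (1 / Real.cos θ ^ 2) * g (Real.tan θ) := by
  have h := lintegral_image_eq_lintegral_abs_deriv_mul (s := Ioo (-(π / 2)) (π / 2))
    (f := Real.tan) (f' := fun θ => 1 / Real.cos θ ^ 2) measurableSet_Ioo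
    (fun x hx => (Real.hasDerivAt_tan (Real.cos_pos_of_mem_Ioo hx).ne').hasDerivWithinAt)
    Real.injOn_tan g
  rw [Real.image_tan_Ioo, Measure.restrict_univ] at h
  rw [h]
  refine lintegral_congr fun θ => ?_
  rw [abs_of_nonneg (by positivity)]

theorem vEven_tan (u : ℝ) (m : ℤ) {θ : ℝ} (hθ : θ ∈ Ioo (-(π / 2)) (π / 2)) :
    vEven (u : ℂ) m (Real.tan θ) =
      ((Real.cos θ ^ (1 + u) : ℝ) : ℂ) * cexp (((2 * m * θ : ℝ) : ℂ) * I) := by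
  have hc : 0 < Real.cos θ := Real.cos_pos_of_mem_Ioo hθ
  have h1 : 1 + Real.tan θ ^ 2 = Real.cos θ ^ (-2 : ℝ) := by
    rw [← Real.inv_sqrt_one_add_tan_sq hc, Real.inv_rpow (Real.sqrt_nonneg _),
      Real.rpow_neg (Real.sqrt_nonneg _), inv_inv, Real.rpow_two, Real.sq_sqrt (by positivity)]
  have h2 : ((1 + Real.tan θ ^ 2 : ℝ) : ℂ) ^ (-(1 + (u : ℂ)) / 2) =
      ((Real.cos θ ^ (1 + u) : ℝ) : ℂ) := by
    have : (-(1 + (u : ℂ)) / 2) = ((-(1 + u) / 2 : ℝ) : ℂ) := by push_cast; ring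
    rw [this, ← Complex.ofReal_cpow (by positivity), h1, ← Real.rpow_mul hc.le]
    congr 2; ring
  have h3 : (1 + (Real.tan θ : ℂ) * I) / (1 - (Real.tan θ : ℂ) * I) =
      cexp (((2 * θ : ℝ) : ℂ) * I) := by
    have hcc : (Real.cos θ : ℂ) ≠ 0 := by exact_mod_cast hc.ne'
    have e1 : 1 + (Real.tan θ : ℂ) * I = cexp (θ * I) / Real.cos θ := by
      rw [Complex.exp_mul_I, Real.tan_eq_sin_div_cos]
      push_cast at hcc ⊢
      field_simp
    have e2 : 1 - (Real.tan θ : ℂ) * I = cexp (-(θ * I)) / Real.cos θ := by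
      rw [← neg_mul, Complex.exp_mul_I, Real.tan_eq_sin_div_cos, Complex.cos_neg, Complex.sin_neg]
      push_cast at hcc ⊢
      field_simp
      ring
    rw [e1, e2, div_div_div_cancel_right₀ hcc, ← Complex.exp_sub]
    congr 1; push_cast; ring
  rw [vEven, h2, h3, ← Complex.exp_int_mul]
  congr 2; push_cast; ring

theorem norm_sq_polar_sub (a b α β : ℝ) :
    ‖(a : ℂ) * cexp (α * I) - (b : ℂ) * cexp (β * I)‖ ^ 2 =
      (a - b) ^ 2 + 4 * (a * b) * Real.sin ((α - β) / 2) ^ 2 := by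
  rw [← Complex.normSq_eq_norm_sq, Complex.normSq_apply]
  have h : Real.cos (α - β) = 1 - 2 * Real.sin ((α - β) / 2) ^ 2 := by
    rw [show α - β = 2 * ((α - β) / 2) by ring, Real.cos_two_mul,
      show 2 * ((α - β) / 2) / 2 = (α - β) / 2 by ring]
    linarith [Real.sin_sq_add_cos_sq ((α - β) / 2)]
  rw [Real.cos_sub] at h
  simp only [Complex.sub_re, Complex.sub_im, Complex.mul_re, Complex.mul_im, Complex.ofReal_re,
    Complex.ofReal_im, Complex.exp_ofReal_mul_I_re, Complex.exp_ofReal_mul_I_im]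
  linear_combination a ^ 2 * Real.sin_sq_add_cos_sq α + b ^ 2 * Real.sin_sq_add_cos_sq β -
    2 * a * b * h

/-- The angular kernel produced by the Cayley transform. -/
def angularKernel (σ : ℝ) (m : ℤ) (t : ℝ) : ℝ≥0∞ :=
  ENNReal.ofReal (|Real.sin t| ^ (-1 - σ)) * ENNReal.ofReal (Real.sin (m * t) ^ 2)

theorem measurable_angularKernel (σ : ℝ) (m : ℤ) : Measurable (angularKernel σ m) := by
  unfold angularKernel; fun_prop

/-- The Gagliardo seminorm of `vEven (-σ) m`. -/
def gagliardoEnergy (σ : ℝ) (m : ℤ) : ℝ≥0∞ :=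
  ∫⁻ x, ∫⁻ y, ENNReal.ofReal (|y - x| ^ (-1 - σ)) *
    ‖vEven ((-σ : ℝ) : ℂ) m y - vEven ((-σ : ℝ) : ℂ) m x‖ₑ ^ 2

/-- The contribution of the phases to the Gagliardo seminorm. -/
def angularEnergy (σ : ℝ) (m : ℤ) : ℝ≥0∞ :=
  ∫⁻ θ in Ioo (-(π / 2)) (π / 2), ∫⁻ φ in Ioo (-(π / 2)) (π / 2), angularKernel σ m (φ - θ)

theorem gagliardo_integrand_tan (σ : ℝ) (m : ℤ) {θ φ : ℝ} (hθ : θ ∈ Ioo (-(π / 2)) (π / 2))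
    (hφ : φ ∈ Ioo (-(π / 2)) (π / 2)) :
    ENNReal.ofReal (1 / Real.cos θ ^ 2) * (ENNReal.ofReal (1 / Real.cos φ ^ 2) *
      (ENNReal.ofReal (|Real.tan φ - Real.tan θ| ^ (-1 - σ)) *
        ‖vEven ((-σ : ℝ) : ℂ) m (Real.tan φ) - vEven ((-σ : ℝ) : ℂ) m (Real.tan θ)‖ₑ ^ 2)) =
    ENNReal.ofReal (1 / Real.cos θ ^ 2 * (1 / Real.cos φ ^ 2 *
      (|Real.tan φ - Real.tan θ| ^ (-1 - σ) *
        (Real.cos φ ^ (1 - σ) - Real.cos θ ^ (1 - σ)) ^ 2))) +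
      4 * angularKernel σ m (φ - θ) := by
  have hct : 0 < Real.cos θ := Real.cos_pos_of_mem_Ioo hθ
  have hcf : 0 < Real.cos φ := Real.cos_pos_of_mem_Ioo hφ
  have hcc : 0 < Real.cos φ * Real.cos θ := mul_pos hcf hct
  have htan : |Real.tan φ - Real.tan θ| = |Real.sin (φ - θ)| / (Real.cos φ * Real.cos θ) := by
    have : Real.tan φ - Real.tan θ = Real.sin (φ - θ) / (Real.cos φ * Real.cos θ) := by
      rw [Real.sin_sub, Real.tan_eq_sin_div_cos, Real.tan_eq_sin_div_cos]
      field_simp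
    rw [this, abs_div, abs_of_pos hcc]
  have hmain : 1 / Real.cos θ ^ 2 * (1 / Real.cos φ ^ 2 *
      (|Real.tan φ - Real.tan θ| ^ (-1 - σ) *
        (4 * (Real.cos φ ^ (1 - σ) * Real.cos θ ^ (1 - σ)) * Real.sin (m * (φ - θ)) ^ 2))) =
      4 * (|Real.sin (φ - θ)| ^ (-1 - σ) * Real.sin (m * (φ - θ)) ^ 2) := by
    rw [htan, Real.div_rpow (abs_nonneg _) hcc.le, ← Real.mul_rpow hcf.le hct.le]
    have h2 : (Real.cos φ * Real.cos θ) ^ (1 - σ) =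
        (Real.cos φ * Real.cos θ) ^ (-1 - σ) * (Real.cos φ * Real.cos θ) ^ 2 := by
      rw [← Real.rpow_two, ← Real.rpow_add hcc]
      congr 1; ring
    rw [h2]
    have h3 : (Real.cos φ * Real.cos θ) ^ (-1 - σ) ≠ 0 := (Real.rpow_pos_of_pos hcc _).ne'
    field_simp
  have hK : 4 * angularKernel σ m (φ - θ) = ENNReal.ofReal
      (4 * (|Real.sin (φ - θ)| ^ (-1 - σ) * Real.sin (m * (φ - θ)) ^ 2)) := by
    rw [angularKernel, ENNReal.ofReal_mul (by norm_num), ENNReal.ofReal_mul (by positivity)]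
    norm_num
  rw [vEven_tan _ _ hθ, vEven_tan _ _ hφ, ← sub_eq_add_neg, ← ofReal_norm,
    ← ENNReal.ofReal_pow (norm_nonneg _), norm_sq_polar_sub,
    show (2 * (m : ℝ) * φ - 2 * m * θ) / 2 = m * (φ - θ) by ring,
    ← ENNReal.ofReal_mul (by positivity), ← ENNReal.ofReal_mul (by positivity),
    ← ENNReal.ofReal_mul (by positivity), mul_add, mul_add, mul_add, hmain,
    ENNReal.ofReal_add (by positivity) (by positivity), hK]

theorem gagliardoEnergy_eq (σ : ℝ) (m : ℤ) :
    gagliardoEnergy σ m = gagliardoEnergy σ 0 + 4 * angularEnergy σ m := by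
  have hz : ∀ t, angularKernel σ 0 t = 0 := fun t => by simp [angularKernel]
  have key : ∀ n : ℤ, gagliardoEnergy σ n =
      (∫⁻ θ in Ioo (-(π / 2)) (π / 2), ∫⁻ φ in Ioo (-(π / 2)) (π / 2),
        ENNReal.ofReal (1 / Real.cos θ ^ 2 * (1 / Real.cos φ ^ 2 *
        (|Real.tan φ - Real.tan θ| ^ (-1 - σ) *
          (Real.cos φ ^ (1 - σ) - Real.cos θ ^ (1 - σ)) ^ 2)))) + 4 * angularEnergy σ n := by
    intro n
    have hK := measurable_angularKernel σ n
    rw [gagliardoEnergy, lintegral_eq_lintegral_tan, angularEnergy,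
      ← lintegral_const_mul _ (by
        refine Measurable.lintegral_prod_right' (f := fun p : ℝ × ℝ =>
          angularKernel σ n (p.2 - p.1)) (by fun_prop)),
      ← lintegral_add_right _ (by
        refine Measurable.const_mul (Measurable.lintegral_prod_right' (f := fun p : ℝ × ℝ =>
          angularKernel σ n (p.2 - p.1)) (by fun_prop)) _)]
    refine setLIntegral_congr_fun measurableSet_Ioo fun θ hθ => ?_
    rw [lintegral_eq_lintegral_tan, ← lintegral_const_mul' _ _ ENNReal.ofReal_ne_top,
      ← lintegral_const_mul _ (by fun_prop), ← lintegral_add_right _ (by fun_prop)]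
    exact setLIntegral_congr_fun measurableSet_Ioo fun φ hφ => gagliardo_integrand_tan σ n hθ hφ
  have h0 : angularEnergy σ 0 = 0 := by simp [angularEnergy, hz]
  rw [key m, key 0, h0, mul_zero, add_zero]

theorem angularKernel_add_pi (σ : ℝ) (m : ℤ) (t : ℝ) :
    angularKernel σ m (t + π) = angularKernel σ m t := by
  have h1 : |Real.sin (t + π)| = |Real.sin t| := by rw [Real.sin_add_pi, abs_neg]
  have h2 : Real.sin (m * (t + π)) ^ 2 = Real.sin (m * t) ^ 2 := by
    rw [mul_add, Real.sin_add_int_mul_pi, mul_pow, ← sq_abs ((-1 : ℝ) ^ m), abs_zpow]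
    simp
  rw [angularKernel, angularKernel, h1, h2]

/-- The integral `∫ |t|^(-1-σ) sin² t dt`. -/
def sineConst (σ : ℝ) : ℝ≥0∞ :=
  ∫⁻ t, ENNReal.ofReal (|t| ^ (-1 - σ)) * ENNReal.ofReal (Real.sin t ^ 2)

theorem sineConst_lt_top {σ : ℝ} (h0 : 0 < σ) (h2 : σ < 2) : sineConst σ < ⊤ := by
  refine lt_of_le_of_lt (lintegral_mono fun t => ?_) (lintegral_rpow_mul_min_lt_top h0 h2)
  rw [← ENNReal.ofReal_mul (by positivity)]
  refine ENNReal.ofReal_le_ofReal (mul_le_mul_of_nonneg_left (le_min ?_ ?_) (by positivity))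
  · exact Real.sin_sq_le_one t
  · rw [Real.rpow_two, sq_abs]
    exact Real.sin_sq_le_sq

theorem lintegral_angularKernel_le {σ : ℝ} (h0 : 0 < σ) {m : ℤ} (hm : m ≠ 0) :
    ∫⁻ t in Icc (-(π / 2)) (π / 2), angularKernel σ m t ≤
      ENNReal.ofReal ((2 / π) ^ (-1 - σ)) *
        (ENNReal.ofReal (|(m : ℝ)| ^ σ) * sineConst σ) := by
  have hm' : (m : ℝ) ≠ 0 := by exact_mod_cast hm
  rw [sineConst, ← lintegral_rpow_mul_comp_mul_left hm' σ
    (fun t => ENNReal.ofReal (Real.sin t ^ 2)),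
    ← lintegral_const_mul' _ _ ENNReal.ofReal_ne_top]
  refine (setLIntegral_mono' measurableSet_Icc fun t ht => ?_).trans
    (setLIntegral_le_lintegral _ _)
  rw [angularKernel, ← mul_assoc,
    ← ENNReal.ofReal_mul (p := (2 / π) ^ (-1 - σ)) (by positivity)]
  rcases eq_or_ne t 0 with rfl | h
  · simp
  refine mul_le_mul_left (ENNReal.ofReal_le_ofReal ?_) _
  rw [← Real.mul_rpow (by positivity) (abs_nonneg t)]
  exact Real.rpow_le_rpow_of_nonpos (by positivity)
    (Real.mul_abs_le_abs_sin (abs_le.2 ht)) (by linarith)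

theorem angularEnergy_le {σ : ℝ} (h0 : 0 < σ) {m : ℤ} (hm : m ≠ 0) :
    angularEnergy σ m ≤ ENNReal.ofReal (|(m : ℝ)| ^ σ) *
      (3 * ENNReal.ofReal ((2 / π) ^ (-1 - σ)) * sineConst σ * ENNReal.ofReal π) := by
  have hK := measurable_angularKernel σ m
  set B := ∫⁻ t in Icc (-(π / 2)) (π / 2), angularKernel σ m t with hB
  set k : ℝ → ℝ≥0∞ := (Icc (-(π / 2)) (π / 2)).indicator (angularKernel σ m) with hk
  have hkm : Measurable k := hK.indicator measurableSet_Icc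
  have hkB : ∀ c : ℝ, ∫⁻ φ, k (φ + c) = B := fun c => by
    rw [lintegral_add_right_eq_self k, hB, hk, lintegral_indicator measurableSet_Icc]
  have hinner : ∀ θ ∈ Ioo (-(π / 2)) (π / 2),
      ∫⁻ φ in Ioo (-(π / 2)) (π / 2), angularKernel σ m (φ - θ) ≤ 3 * B := by
    intro θ hθ
    have h3 : ∫⁻ φ, (k (φ + -θ) + k (φ + (-θ + π)) + k (φ + (-θ - π))) = 3 * B := by
      rw [lintegral_add_left (by fun_prop), lintegral_add_left (by fun_prop), hkB, hkB, hkB]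
      ring
    rw [← h3]
    refine (setLIntegral_mono' measurableSet_Ioo fun φ hφ => ?_).trans
      (setLIntegral_le_lintegral _ _)
    have hin : ∀ t, t ∈ Icc (-(π / 2)) (π / 2) → k t = angularKernel σ m t := fun t ht =>
      indicator_of_mem ht _
    rcases lt_or_ge (φ - θ) (-(π / 2)) with h | h
    · have : k (φ + (-θ + π)) = angularKernel σ m (φ - θ) := by
        rw [hin _ ⟨by linarith [hφ.1, hθ.2], by linarith⟩, ← angularKernel_add_pi σ m (φ - θ)]
        congr 1; ring
      rw [← this]
      exact le_add_right le_add_self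
    rcases le_or_gt (φ - θ) (π / 2) with h' | h'
    · have : k (φ + -θ) = angularKernel σ m (φ - θ) := by
        rw [hin _ ⟨by linarith, by linarith⟩]; rfl
      rw [← this]
      exact le_add_right le_self_add
    · have : k (φ + (-θ - π)) = angularKernel σ m (φ - θ) := by
        rw [hin _ ⟨by linarith, by linarith [hφ.2, hθ.1]⟩, ← angularKernel_add_pi]
        congr 1; ring
      rw [← this]
      exact le_add_self
  calc angularEnergy σ m ≤ ∫⁻ θ in Ioo (-(π / 2)) (π / 2), 3 * B :=
        setLIntegral_mono' measurableSet_Ioo hinner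
    _ = 3 * B * ENNReal.ofReal π := by
        rw [setLIntegral_const, Real.volume_Ioo]; congr 2; ring
    _ ≤ 3 * (ENNReal.ofReal ((2 / π) ^ (-1 - σ)) *
        (ENNReal.ofReal (|(m : ℝ)| ^ σ) * sineConst σ)) * ENNReal.ofReal π := by
        gcongr
        exact lintegral_angularKernel_le h0 hm
    _ = _ := by ring

/-- The integral `∫ |t|^(-1-σ) sin² t dt` over `|t| < π / 4`. -/
def localSineConst (σ : ℝ) : ℝ≥0∞ :=
  ∫⁻ t in Ioo (-(π / 4)) (π / 4), ENNReal.ofReal (|t| ^ (-1 - σ)) * ENNReal.ofReal (Real.sin t ^ 2)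

theorem localSineConst_pos (σ : ℝ) : 0 < localSineConst σ := by
  have := lintegral_rpow_mul_sq_sin_pos σ (c := 1) (r := π / 4) one_ne_zero (by positivity)
  simpa only [localSineConst, one_mul] using this

theorem le_lintegral_angularKernel {σ : ℝ} (h0 : 0 < σ) {m : ℤ} (hm : m ≠ 0) :
    ENNReal.ofReal (|(m : ℝ)| ^ σ) * localSineConst σ ≤
      ∫⁻ t in Ioo (-(π / 4)) (π / 4), angularKernel σ m t := by
  have hm' : (m : ℝ) ≠ 0 := by exact_mod_cast hm
  have hm1 : 1 ≤ |(m : ℝ)| := by exact_mod_cast Int.one_le_abs hm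
  have hpi := Real.pi_pos
  have h1 : localSineConst σ = ∫⁻ t, ENNReal.ofReal (|t| ^ (-1 - σ)) *
      (Ioo (-(π / 4)) (π / 4)).indicator (fun t => ENNReal.ofReal (Real.sin t ^ 2)) t := by
    rw [localSineConst, ← lintegral_indicator measurableSet_Ioo]
    refine lintegral_congr fun t => ?_
    by_cases ht : t ∈ Ioo (-(π / 4)) (π / 4) <;> simp [ht]
  rw [h1, ← lintegral_rpow_mul_comp_mul_left hm', ← lintegral_indicator measurableSet_Ioo]
  refine lintegral_mono fun t => ?_
  by_cases ht : (m : ℝ) * t ∈ Ioo (-(π / 4)) (π / 4)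
  · have ht' : |t| < π / 4 := by
      have h2 : |(m : ℝ)| * |t| < π / 4 := by rw [← abs_mul]; exact abs_lt.2 ht
      nlinarith [abs_nonneg t]
    rw [indicator_of_mem ht, indicator_of_mem (show t ∈ Ioo (-(π / 4)) (π / 4) from abs_lt.1 ht'), angularKernel]
    rcases eq_or_ne t 0 with rfl | h
    · simp
    refine mul_le_mul_left (ENNReal.ofReal_le_ofReal ?_) _
    have hpos : 0 < |Real.sin t| := by
      have := Real.mul_abs_le_abs_sin (x := t) (by linarith)
      have h3 : 0 < 2 / π * |t| := by positivity
      linarith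
    exact Real.rpow_le_rpow_of_nonpos hpos Real.abs_sin_le_abs (by linarith)
  · rw [indicator_of_notMem ht, mul_zero]
    exact zero_le

theorem le_angularEnergy {σ : ℝ} (h0 : 0 < σ) {m : ℤ} (hm : m ≠ 0) :
    ENNReal.ofReal (|(m : ℝ)| ^ σ) * (localSineConst σ * ENNReal.ofReal (π / 2)) ≤
      angularEnergy σ m := by
  have hpi := Real.pi_pos
  have hsub : Ioo (-(π / 4)) (π / 4) ⊆ Ioo (-(π / 2)) (π / 2) :=
    Ioo_subset_Ioo (by linarith) (by linarith)
  calc ENNReal.ofReal (|(m : ℝ)| ^ σ) * (localSineConst σ * ENNReal.ofReal (π / 2))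
      = ∫⁻ θ in Ioo (-(π / 4)) (π / 4), ENNReal.ofReal (|(m : ℝ)| ^ σ) * localSineConst σ := by
        rw [setLIntegral_const, Real.volume_Ioo, mul_assoc]; congr 3; ring
    _ ≤ ∫⁻ θ in Ioo (-(π / 4)) (π / 4), ∫⁻ φ in Ioo (-(π / 2)) (π / 2),
          angularKernel σ m (φ - θ) := by
        refine setLIntegral_mono' measurableSet_Ioo fun θ hθ => ?_
        refine (le_lintegral_angularKernel h0 hm).trans ?_
        rw [← lintegral_indicator measurableSet_Ioo, ← lintegral_indicator measurableSet_Ioo,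
          ← lintegral_add_right_eq_self _ (-θ)]
        refine lintegral_mono fun φ => ?_
        by_cases hφ : φ + -θ ∈ Ioo (-(π / 4)) (π / 4)
        · have hφ' : φ ∈ Ioo (-(π / 2)) (π / 2) :=
            ⟨by linarith [hφ.1, hθ.1], by linarith [hφ.2, hθ.2]⟩
          rw [indicator_of_mem hφ, indicator_of_mem hφ']
          rfl
        · rw [indicator_of_notMem hφ]
          exact zero_le
    _ ≤ angularEnergy σ m := lintegral_mono_set hsub

theorem norm_vEven (u : ℝ) (m : ℤ) (x : ℝ) :
    ‖vEven (u : ℂ) m x‖ = (1 + x ^ 2) ^ (-(1 + u) / 2) := by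
  have h1 : ‖(1 + (x : ℂ) * I) / (1 - (x : ℂ) * I)‖ = 1 := by
    have hconj : (1 - (x : ℂ) * I) = (starRingEnd ℂ) (1 + (x : ℂ) * I) := by simp [sub_eq_add_neg]
    have h0 : (1 + (x : ℂ) * I) ≠ 0 := fun h => by simpa using congrArg Complex.re h
    rw [hconj, norm_div, Complex.norm_conj, div_self (norm_ne_zero_iff.2 h0)]
  rw [vEven, norm_mul, norm_zpow, h1, one_zpow, mul_one,
    Complex.norm_cpow_eq_rpow_re_of_pos (by positivity)]
  simp

theorem norm_vEven_le_one {u : ℝ} (hu : -1 < u) (m : ℤ) (x : ℝ) : ‖vEven (u : ℂ) m x‖ ≤ 1 := by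
  rw [norm_vEven]
  exact Real.rpow_le_one_of_one_le_of_nonpos (by nlinarith [sq_nonneg x]) (by linarith)

/-- The derivative of `vEven u m`. -/
def vEvenDeriv (u : ℝ) (m : ℤ) (x : ℝ) : ℂ :=
  vEven (u : ℂ) m x * ((2 * m * I - (1 + u) * x) / (1 + x ^ 2 : ℝ))

theorem hasDerivAt_vEven (u : ℝ) (m : ℤ) (x : ℝ) :
    HasDerivAt (vEven (u : ℂ) m) (vEvenDeriv u m x) x := by
  have hx : HasDerivAt (fun x : ℝ => (x : ℂ)) 1 x := Complex.ofRealCLM.hasDerivAt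
  have hp0 : (1 + (x : ℂ) * I) ≠ 0 := fun h => by simpa using congrArg Complex.re h
  have hm0 : (1 - (x : ℂ) * I) ≠ 0 := fun h => by simpa using congrArg Complex.re h
  have hq : ((1 + x ^ 2 : ℝ) : ℂ) = (1 + (x : ℂ) * I) * (1 - (x : ℂ) * I) := by
    push_cast; linear_combination (x : ℂ) ^ 2 * I_sq
  have hq0 : ((1 + x ^ 2 : ℝ) : ℂ) ≠ 0 := by rw [hq]; exact mul_ne_zero hp0 hm0
  have hA : HasDerivAt (fun z : ℂ => (1 + z ^ 2 : ℂ)) (2 * (x : ℂ)) (x : ℂ) := by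
    simpa using (hasDerivAt_pow 2 (x : ℂ)).const_add 1
  have hs : 1 + (x : ℂ) ^ 2 ∈ Complex.slitPlane := Or.inl (by
    rw [← Complex.ofReal_pow, ← Complex.ofReal_one, ← Complex.ofReal_add, Complex.ofReal_re]
    positivity)
  have hA' := (HasDerivAt.cpow_const (c := -(1 + (u : ℂ)) / 2) hA hs).comp_ofReal
  have hP : HasDerivAt (fun x : ℝ => 1 + (x : ℂ) * I) I x := by
    simpa using (hx.mul_const I).const_add 1
  have hM : HasDerivAt (fun x : ℝ => 1 - (x : ℂ) * I) (-I) x := by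
    simpa using (hx.mul_const I).const_sub 1
  have hr0 : (1 + (x : ℂ) * I) / (1 - (x : ℂ) * I) ≠ 0 := div_ne_zero hp0 hm0
  have hB := (hasDerivAt_zpow m _ (Or.inl hr0)).comp x (hP.fun_div hM hm0)
  have h := hA'.mul hB
  have hf : vEven (u : ℂ) m = (fun y : ℝ => (1 + (y : ℂ) ^ 2) ^ (-(1 + (u : ℂ)) / 2)) *
      ((fun z : ℂ => z ^ m) ∘ fun y : ℝ => (1 + (y : ℂ) * I) / (1 - (y : ℂ) * I)) := by
    ext y
    simp [vEven]
  rw [hf]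
  have hq1 : (1 + (x : ℂ) ^ 2) = (1 + (x : ℂ) * I) * (1 - (x : ℂ) * I) := by
    rw [← hq]; push_cast; rfl
  have hc0 : (1 + (x : ℂ) ^ 2) ≠ 0 := by rw [hq1]; exact mul_ne_zero hp0 hm0
  refine h.congr_deriv ?_
  rw [vEvenDeriv, vEven, Complex.cpow_sub _ _ hc0, Complex.cpow_one, zpow_sub_one₀ hr0]
  simp only [Function.comp_apply, Complex.ofReal_add, Complex.ofReal_one, Complex.ofReal_pow]
  generalize (1 + (x : ℂ) ^ 2) ^ (-(1 + (u : ℂ)) / 2) = w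
  generalize ((1 + (x : ℂ) * I) / (1 - (x : ℂ) * I)) ^ m = z
  rw [hq1]
  field_simp
  ring

theorem norm_vEvenDeriv_le {u : ℝ} (m : ℤ) (x : ℝ) :
    ‖vEvenDeriv u m x‖ ≤ (2 * |(m : ℝ)| + |1 + u|) * (1 + x ^ 2) ^ (-(2 + u) / 2) := by
  have h1 : 0 < 1 + x ^ 2 := by positivity
  have h2 : |x| ≤ (1 + x ^ 2) ^ (1 / 2 : ℝ) := by
    rw [← Real.sqrt_eq_rpow]
    exact Real.abs_le_sqrt (by linarith)
  have h3 : 1 ≤ (1 + x ^ 2) ^ (1 / 2 : ℝ) :=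
    Real.one_le_rpow (by nlinarith [sq_nonneg x]) (by norm_num)
  have h4 : ‖(2 * m * I - (1 + u) * x : ℂ)‖ ≤
      (2 * |(m : ℝ)| + |1 + u|) * (1 + x ^ 2) ^ (1 / 2 : ℝ) := by
    refine (norm_sub_le _ _).trans ?_
    have e1 : ‖(2 * m * I : ℂ)‖ = 2 * |(m : ℝ)| := by simp
    have e2 : ‖((1 + u) * x : ℂ)‖ = |1 + u| * |x| := by
      rw [norm_mul, Complex.norm_real, ← Complex.ofReal_one, ← Complex.ofReal_add,
        Complex.norm_real, Real.norm_eq_abs, Real.norm_eq_abs]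
    rw [e1, e2, add_mul]
    exact add_le_add (le_mul_of_one_le_right (by positivity) h3)
      (mul_le_mul_of_nonneg_left h2 (abs_nonneg _))
  rw [vEvenDeriv, norm_mul, norm_vEven, norm_div, Complex.norm_real, Real.norm_of_nonneg h1.le]
  calc (1 + x ^ 2) ^ (-(1 + u) / 2) * (‖(2 * m * I - (1 + u) * x : ℂ)‖ / (1 + x ^ 2))
      ≤ (1 + x ^ 2) ^ (-(1 + u) / 2) *
        ((2 * |(m : ℝ)| + |1 + u|) * (1 + x ^ 2) ^ (1 / 2 : ℝ) / (1 + x ^ 2)) := by gcongr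
    _ = (2 * |(m : ℝ)| + |1 + u|) * ((1 + x ^ 2) ^ (-(1 + u) / 2) *
        (1 + x ^ 2) ^ (1 / 2 : ℝ) * (1 + x ^ 2) ^ (-1 : ℝ)) := by
        rw [Real.rpow_neg_one]; ring
    _ = _ := by
        rw [← Real.rpow_add h1, ← Real.rpow_add h1]
        congr 2; ring

theorem integrable_one_add_sq_rpow {r : ℝ} (hr : 1 < r) :
    Integrable fun x : ℝ => (1 + x ^ 2) ^ (-r / 2) := by
  have := integrable_rpow_neg_one_add_norm_sq (E := ℝ) (μ := volume) (r := r) (by simpa using hr)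
  simpa using this

theorem measurable_vEvenDeriv (u : ℝ) (m : ℤ) : Measurable (vEvenDeriv u m) := by
  have : vEvenDeriv u m = deriv (vEven (u : ℂ) m) :=
    funext fun x => (hasDerivAt_vEven u m x).deriv.symm
  rw [this]
  exact measurable_deriv _

theorem integrable_vEvenDeriv {u : ℝ} (hu : -1 < u) (m : ℤ) : Integrable (vEvenDeriv u m) :=
  ((integrable_one_add_sq_rpow (r := 2 + u) (by linarith)).const_mul
    (2 * |(m : ℝ)| + |1 + u|)).mono' (measurable_vEvenDeriv u m).aestronglyMeasurable
    (Eventually.of_forall fun x => norm_vEvenDeriv_le m x)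

theorem tendsto_vEven {u : ℝ} (hu : -1 < u) (m : ℤ) {l : Filter ℝ}
    (hl : Tendsto (fun x : ℝ => |x|) l atTop) : Tendsto (vEven (u : ℂ) m) l (nhds 0) := by
  rw [tendsto_zero_iff_norm_tendsto_zero]
  simp_rw [norm_vEven]
  have h1 : Tendsto (fun x : ℝ => 1 + x ^ 2) l atTop := by
    have := tendsto_atTop_add_const_left l (1 : ℝ) ((tendsto_pow_atTop two_ne_zero).comp hl)
    simpa using this
  have h2 := (tendsto_rpow_neg_atTop (y := (1 + u) / 2) (by linarith)).comp h1
  refine h2.congr fun x => ?_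
  simp only [Function.comp_apply]
  congr 1; ring

theorem isImpFT_vEven {u : ℝ} (hu : -1 < u) (m : ℤ) {ξ : ℝ} (hξ : ξ ≠ 0) :
    IsImpFT (vEven (u : ℂ) m) ξ (derivFT (vEvenDeriv u m) ξ) :=
  isImpFT_derivFT (hasDerivAt_vEven u m) (integrable_vEvenDeriv hu m)
    (tendsto_vEven hu m tendsto_abs_atTop_atTop) (tendsto_vEven hu m tendsto_abs_atBot_atTop) hξ

theorem norm_exp_I_sub_one_le_rpow {β : ℝ} (h0 : 0 ≤ β) (h1 : β ≤ 1) (y : ℝ) :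
    ‖cexp ((y : ℂ) * I) - 1‖ ≤ 2 * |y| ^ β := by
  rcases le_total |y| 1 with h | h
  · have e := Real.norm_exp_I_mul_ofReal_sub_one_le (x := y)
    rw [mul_comm, Real.norm_eq_abs] at e
    have e2 : |y| ≤ |y| ^ β := by
      rcases (abs_nonneg y).eq_or_lt with h' | h'
      · rw [← h']; positivity
      · simpa using Real.rpow_le_rpow_of_exponent_ge h' h h1
    have e3 : 0 ≤ |y| ^ β := by positivity
    linarith
  · have e := norm_sub_le (cexp ((y : ℂ) * I)) 1
    rw [Complex.norm_exp_ofReal_mul_I, norm_one] at e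
    have := Real.one_le_rpow h h0
    linarith

open FourierTransform in
theorem norm_fourier_le_min {g : ℝ → ℂ} (hg : Integrable g) (hz : ∫ x, g x = 0) {β : ℝ}
    (h0 : 0 ≤ β) (h1 : β ≤ 1) (hβ : Integrable fun x => |x| ^ β * ‖g x‖) :
    ∃ K : ℝ, 0 ≤ K ∧ ∀ ξ, ‖𝓕 g ξ‖ ≤ K * min 1 (|ξ| ^ β) := by
  set K1 := ∫ x, ‖g x‖
  set K2 := 2 * (2 * π) ^ β * ∫ x, |x| ^ β * ‖g x‖ with hK2
  have hK1 : 0 ≤ K1 := integral_nonneg fun x => norm_nonneg _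
  refine ⟨max K1 K2, le_max_of_le_left hK1, fun ξ => ?_⟩
  rw [mul_min_of_nonneg _ _ (le_max_of_le_left hK1)]
  rw [Real.fourier_real_eq_integral_exp_smul]
  refine le_min ?_ ?_
  · rw [mul_one]
    refine (norm_integral_le_integral_norm _).trans (le_max_of_le_left (le_of_eq ?_))
    congr 1; ext x
    rw [norm_smul, Complex.norm_exp_ofReal_mul_I, one_mul]
  · have hi : Integrable (fun v : ℝ => cexp (↑(-2 * π * v * ξ) * I) • g v) :=
      hg.bdd_mul (c := 1) (by fun_prop)
        (Eventually.of_forall fun x => (Complex.norm_exp_ofReal_mul_I _).le)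
    have e : ∫ v : ℝ, cexp (↑(-2 * π * v * ξ) * I) • g v =
        ∫ v : ℝ, (cexp (↑(-2 * π * v * ξ) * I) - 1) • g v := by
      simp_rw [sub_smul, one_smul]
      rw [integral_sub hi hg, hz, sub_zero]
    rw [e]
    calc ‖∫ v : ℝ, (cexp (↑(-2 * π * v * ξ) * I) - 1) • g v‖
        ≤ ∫ v : ℝ, (2 * (2 * π) ^ β * |ξ| ^ β) * (|v| ^ β * ‖g v‖) := by
          refine norm_integral_le_of_norm_le (hβ.const_mul _) (Eventually.of_forall fun v => ?_)
          rw [norm_smul]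
          have := norm_exp_I_sub_one_le_rpow h0 h1 (-2 * π * v * ξ)
          have e2 : |-2 * π * v * ξ| ^ β = (2 * π) ^ β * |v| ^ β * |ξ| ^ β := by
            rw [abs_mul, abs_mul, abs_mul, abs_of_pos Real.pi_pos, abs_neg, abs_two,
              Real.mul_rpow (by positivity) (by positivity),
              Real.mul_rpow (by positivity) (by positivity)]
          rw [e2] at this
          calc _ ≤ 2 * ((2 * π) ^ β * |v| ^ β * |ξ| ^ β) * ‖g v‖ := by gcongr
            _ = _ := by ring
      _ = K2 * |ξ| ^ β := by rw [integral_const_mul, hK2]; ring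
      _ ≤ max K1 K2 * |ξ| ^ β := by gcongr; exact le_max_right _ _

/-- The complementary-series norm squared of `vEven u m`. -/
def complNorm (u : ℝ) (m : ℤ) : ℝ≥0∞ :=
  ∫⁻ ξ, ENNReal.ofReal (|ξ| ^ (-u)) * ‖derivFT (vEvenDeriv u m) ξ‖ₑ ^ 2

theorem integral_vEvenDeriv {u : ℝ} (hu : -1 < u) (m : ℤ) : ∫ x, vEvenDeriv u m x = 0 := by
  have := integral_of_hasDerivAt_of_tendsto (hasDerivAt_vEven u m) (integrable_vEvenDeriv hu m)
    (tendsto_vEven hu m tendsto_abs_atBot_atTop) (tendsto_vEven hu m tendsto_abs_atTop_atTop)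
  simpa using this

theorem integrable_rpow_mul_norm_vEvenDeriv {u β : ℝ} (h0 : 0 ≤ β) (h : β < 1 + u) (m : ℤ) :
    Integrable fun x : ℝ => |x| ^ β * ‖vEvenDeriv u m x‖ := by
  refine ((integrable_one_add_sq_rpow (r := 2 + u - β) (by linarith)).const_mul
    (2 * |(m : ℝ)| + |1 + u|)).mono' ?_ (Eventually.of_forall fun x => ?_)
  · exact ((measurable_abs_rpow β).mul (measurable_vEvenDeriv u m).norm).aestronglyMeasurable
  · have hp : 0 < 1 + x ^ 2 := by positivity
    have h1 : |x| ^ β ≤ (1 + x ^ 2) ^ (β / 2) := by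
      have e : (1 + x ^ 2) ^ (β / 2) = √(1 + x ^ 2) ^ β := by
        rw [Real.sqrt_eq_rpow, ← Real.rpow_mul hp.le]
        congr 1; ring
      rw [e]
      exact Real.rpow_le_rpow (abs_nonneg x) (Real.abs_le_sqrt (by linarith)) h0
    rw [Real.norm_of_nonneg (by positivity)]
    calc |x| ^ β * ‖vEvenDeriv u m x‖
        ≤ (1 + x ^ 2) ^ (β / 2) *
          ((2 * |(m : ℝ)| + |1 + u|) * (1 + x ^ 2) ^ (-(2 + u) / 2)) := by
          gcongr
          exact norm_vEvenDeriv_le m x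
      _ = (2 * |(m : ℝ)| + |1 + u|) *
          ((1 + x ^ 2) ^ (β / 2) * (1 + x ^ 2) ^ (-(2 + u) / 2)) := by ring
      _ = _ := by
          rw [← Real.rpow_add hp]
          congr 2; ring

theorem complNorm_lt_top {u : ℝ} (hu : -1 < u) (hu1 : u ≤ 0) (m : ℤ) : complNorm u m < ⊤ := by
  set β := 3 / 4 * (1 + u) with hβ
  have hβ0 : 0 ≤ β := by linarith
  obtain ⟨K, hK0, hK⟩ := norm_fourier_le_min (integrable_vEvenDeriv hu m)
    (integral_vEvenDeriv hu m) hβ0 (by linarith)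
    (integrable_rpow_mul_norm_vEvenDeriv hβ0 (by linarith) m)
  have hlt := lintegral_rpow_mul_min_lt_top (a := 1 + u) (b := 2 * β) (by linarith) (by linarith)
  refine lt_of_le_of_lt (b := ENNReal.ofReal ((K / (2 * π)) ^ 2) *
    ∫⁻ t : ℝ, ENNReal.ofReal (|t| ^ (-1 - (1 + u)) * min 1 (|t| ^ (2 * β)))) ?_
    (ENNReal.mul_lt_top ENNReal.ofReal_lt_top hlt)
  rw [← lintegral_const_mul' _ _ ENNReal.ofReal_ne_top, complNorm]
  refine lintegral_mono fun ξ => ?_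
  rcases eq_or_ne ξ 0 with rfl | hξ
  · simp [derivFT]
  have hpos : 0 < |ξ| := abs_pos.2 hξ
  have hn : ‖derivFT (vEvenDeriv u m) ξ‖ ≤ K / (2 * π) * (|ξ| ^ (-1 : ℝ) * min 1 (|ξ| ^ β)) := by
    have e : ‖(2 * π * I * ξ : ℂ)‖ = 2 * π * |ξ| := by
      simp [abs_of_pos Real.pi_pos]
    rw [derivFT, norm_div, e, Real.rpow_neg_one, div_le_iff₀ (by positivity)]
    refine (hK ξ).trans (le_of_eq ?_)
    field_simp
  have hmin : min 1 (|ξ| ^ β) ^ 2 ≤ min 1 (|ξ| ^ (2 * β)) := by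
    refine le_min (pow_le_one₀ (by positivity) (min_le_left _ _)) ?_
    rw [mul_comm 2 β, Real.rpow_mul hpos.le β, Real.rpow_two]
    exact pow_le_pow_left₀ (by positivity) (min_le_right _ _) 2
  rw [← ofReal_norm, ← ENNReal.ofReal_pow (norm_nonneg _),
    ← ENNReal.ofReal_mul (by positivity), ← ENNReal.ofReal_mul (by positivity)]
  refine ENNReal.ofReal_le_ofReal ?_
  calc |ξ| ^ (-u) * ‖derivFT (vEvenDeriv u m) ξ‖ ^ 2
      ≤ |ξ| ^ (-u) * (K / (2 * π) * (|ξ| ^ (-1 : ℝ) * min 1 (|ξ| ^ β))) ^ 2 := by gcongr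
    _ = (K / (2 * π)) ^ 2 * ((|ξ| ^ (-u) * |ξ| ^ (-1 : ℝ) * |ξ| ^ (-1 : ℝ)) *
        min 1 (|ξ| ^ β) ^ 2) := by ring
    _ = (K / (2 * π)) ^ 2 * (|ξ| ^ (-1 - (1 + u)) * min 1 (|ξ| ^ β) ^ 2) := by
        rw [← Real.rpow_add hpos, ← Real.rpow_add hpos]
        congr 3; ring
    _ ≤ _ := by gcongr

theorem sub_rpow_le_norm_vEven_sub {u : ℝ} (hu : -1 < u) (m : ℤ) {x y : ℝ} (hx0 : 0 ≤ x)
    (hx : x ≤ 1) (hy : 10 ≤ y) :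
    (2 : ℝ) ^ (-(1 + u) / 2) - 101 ^ (-(1 + u) / 2) ≤
      ‖vEven (u : ℂ) m y - vEven (u : ℂ) m x‖ := by
  have h := norm_sub_norm_le (vEven (u : ℂ) m x) (vEven (u : ℂ) m y)
  rw [norm_vEven, norm_vEven, norm_sub_rev] at h
  have h1 : (2 : ℝ) ^ (-(1 + u) / 2) ≤ (1 + x ^ 2) ^ (-(1 + u) / 2) :=
    Real.rpow_le_rpow_of_nonpos (by positivity) (by nlinarith) (by linarith)
  have h2 : (1 + y ^ 2) ^ (-(1 + u) / 2) ≤ (101 : ℝ) ^ (-(1 + u) / 2) :=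
    Real.rpow_le_rpow_of_nonpos (by positivity) (by nlinarith) (by linarith)
  linarith

theorem sub_rpow_pos {u : ℝ} (hu : -1 < u) :
    0 < (2 : ℝ) ^ (-(1 + u) / 2) - 101 ^ (-(1 + u) / 2) :=
  sub_pos.2 (Real.rpow_lt_rpow_of_neg (by norm_num) (by norm_num) (by linarith))

theorem gagliardoEnergy_pos {σ : ℝ} (hσ : σ < 1) (h0 : 0 < σ) (m : ℤ) :
    0 < gagliardoEnergy σ m := by
  have hu : -1 < -σ := by linarith
  set δ := (2 : ℝ) ^ (-(1 + -σ) / 2) - 101 ^ (-(1 + -σ) / 2) with hδ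
  have hδ0 : 0 < δ := sub_rpow_pos hu
  set c : ℝ≥0∞ := ENNReal.ofReal ((11 : ℝ) ^ (-1 - σ)) * ENNReal.ofReal δ ^ 2 with hc
  have hc0 : 0 < c := by
    have h1 : 0 < ENNReal.ofReal ((11 : ℝ) ^ (-1 - σ)) := ENNReal.ofReal_pos.2 (by positivity)
    have h2 : 0 < ENNReal.ofReal δ := ENNReal.ofReal_pos.2 hδ0
    positivity
  have hin : ∀ x ∈ Ioc (0 : ℝ) 1, c ≤ ∫⁻ y, ENNReal.ofReal (|y - x| ^ (-1 - σ)) *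
      ‖vEven ((-σ : ℝ) : ℂ) m y - vEven ((-σ : ℝ) : ℂ) m x‖ₑ ^ 2 := fun x hx => by
    calc c = ∫⁻ _ in Ioc (10 : ℝ) 11, c := by
          rw [setLIntegral_const, Real.volume_Ioc]; norm_num
      _ ≤ ∫⁻ y in Ioc (10 : ℝ) 11, ENNReal.ofReal (|y - x| ^ (-1 - σ)) *
          ‖vEven ((-σ : ℝ) : ℂ) m y - vEven ((-σ : ℝ) : ℂ) m x‖ₑ ^ 2 := by
          refine setLIntegral_mono' measurableSet_Ioc fun y hy => ?_
          rw [hc]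
          have hyx : 0 < y - x := by linarith [hy.1, hx.2]
          refine mul_le_mul' (ENNReal.ofReal_le_ofReal ?_) (pow_le_pow_left' ?_ 2)
          · rw [abs_of_pos hyx]
            exact Real.rpow_le_rpow_of_nonpos hyx (by linarith [hy.2, hx.1]) (by linarith)
          · rw [← ofReal_norm]
            exact ENNReal.ofReal_le_ofReal
              (sub_rpow_le_norm_vEven_sub hu m hx.1.le hx.2 hy.1.le)
      _ ≤ _ := setLIntegral_le_lintegral _ _
  calc 0 < c := hc0
    _ = ∫⁻ _ in Ioc (0 : ℝ) 1, c := by rw [setLIntegral_const, Real.volume_Ioc]; norm_num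
    _ ≤ ∫⁻ x in Ioc (0 : ℝ) 1, ∫⁻ y, ENNReal.ofReal (|y - x| ^ (-1 - σ)) *
          ‖vEven ((-σ : ℝ) : ℂ) m y - vEven ((-σ : ℝ) : ℂ) m x‖ₑ ^ 2 :=
        setLIntegral_mono' measurableSet_Ioc hin
    _ ≤ _ := setLIntegral_le_lintegral _ _

theorem gagliardoEnergy_eq_mul_complNorm {σ : ℝ} (hσ : σ < 1) (m : ℤ) :
    gagliardoEnergy σ m = gagliardoConst σ * complNorm (-σ) m := by
  have hu : -1 < -σ := by linarith
  rw [gagliardoEnergy, complNorm, neg_neg]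
  exact gagliardo_eq (hasDerivAt_vEven (-σ) m) (integrable_vEvenDeriv hu m)
    (norm_vEven_le_one hu m)

/-- Two-sided bounds for the norms in the range `-1 < u < 0`, where `σ = -u`. -/
theorem exists_complNorm_bounds_of_neg {σ : ℝ} (h0 : 0 < σ) (hσ : σ < 1) :
    ∃ L U : ℝ≥0∞, 0 < L ∧ U < ⊤ ∧ ∀ m : ℤ,
      L * ENNReal.ofReal ((1 + (m : ℝ) ^ 2) ^ (σ / 2)) ≤ complNorm (-σ) m ∧
      complNorm (-σ) m ≤ U * ENNReal.ofReal ((1 + (m : ℝ) ^ 2) ^ (σ / 2)) := by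
  set A := gagliardoConst σ with hA
  have hA0 : A ≠ 0 := (gagliardoConst_pos σ).ne'
  have hAt : A ≠ ⊤ := (gagliardoConst_lt_top h0 (by linarith)).ne
  set D := gagliardoEnergy σ 0 with hD
  have hD0 : 0 < D := gagliardoEnergy_pos hσ h0 0
  have hDt : D < ⊤ := by
    rw [hD, gagliardoEnergy_eq_mul_complNorm hσ]
    exact ENNReal.mul_lt_top hAt.lt_top (complNorm_lt_top (by linarith) (by linarith) 0)
  set K := 3 * ENNReal.ofReal ((2 / π) ^ (-1 - σ)) * sineConst σ * ENNReal.ofReal π with hK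
  have hKt : K < ⊤ := by
    have := sineConst_lt_top h0 (show σ < 2 by linarith)
    exact ENNReal.mul_lt_top (ENNReal.mul_lt_top (ENNReal.mul_lt_top (by norm_num)
      ENNReal.ofReal_lt_top) this) ENNReal.ofReal_lt_top
  set k := localSineConst σ * ENNReal.ofReal (π / 2) with hk
  have hk0 : 0 < k := ENNReal.mul_pos (localSineConst_pos σ).ne'
    (ENNReal.ofReal_pos.2 (by positivity)).ne'
  set r := ENNReal.ofReal ((2 : ℝ) ^ (-(σ / 2))) with hr
  have hr0 : 0 < r := ENNReal.ofReal_pos.2 (by positivity)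
  have key : ∀ m : ℤ, complNorm (-σ) m = (D + 4 * angularEnergy σ m) / A := fun m => by
    rw [hD, ← gagliardoEnergy_eq, gagliardoEnergy_eq_mul_complNorm hσ, mul_comm,
      ENNReal.mul_div_cancel_right hA0 hAt]
  refine ⟨min D (4 * k * r) / A, (D + 4 * K) / A, ?_, ?_, fun m => ?_⟩
  · exact ENNReal.div_pos (lt_min hD0 (ENNReal.mul_pos (mul_ne_zero (by norm_num) hk0.ne')
      hr0.ne')).ne' hAt
  · exact ENNReal.div_lt_top (ENNReal.add_lt_top.2
      ⟨hDt, ENNReal.mul_lt_top (by norm_num) hKt⟩).ne hA0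
  rw [key, ← ENNReal.mul_div_right_comm, ← ENNReal.mul_div_right_comm]
  have hm1 : 1 ≤ 1 + (m : ℝ) ^ 2 := by nlinarith [sq_nonneg (m : ℝ)]
  have hp1 : 1 ≤ ENNReal.ofReal ((1 + (m : ℝ) ^ 2) ^ (σ / 2)) := by
    rw [ENNReal.one_le_ofReal]
    exact Real.one_le_rpow hm1 (by linarith)
  set p := ENNReal.ofReal ((1 + (m : ℝ) ^ 2) ^ (σ / 2)) with hp
  have habs : |(m : ℝ)| ^ σ = ((m : ℝ) ^ 2) ^ (σ / 2) := by
    rw [← sq_abs, ← Real.rpow_two, ← Real.rpow_mul (abs_nonneg _)]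
    congr 1; ring
  refine ⟨ENNReal.div_le_div_right ?_ _, ENNReal.div_le_div_right ?_ _⟩
  · rcases eq_or_ne m 0 with rfl | hm
    · have : p = 1 := by simp [hp]
      rw [this, mul_one]
      exact (min_le_left _ _).trans le_self_add
    · have h1 : (1 : ℝ) ≤ (m : ℝ) ^ 2 := by
        rw [← sq_abs]
        have : (1 : ℝ) ≤ |(m : ℝ)| := by exact_mod_cast Int.one_le_abs hm
        nlinarith
      have hpr : r * p ≤ ENNReal.ofReal (|(m : ℝ)| ^ σ) := by
        rw [hr, hp, ← ENNReal.ofReal_mul (by positivity)]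
        refine ENNReal.ofReal_le_ofReal ?_
        rw [habs, Real.rpow_neg (by norm_num), inv_mul_le_iff₀ (by positivity),
          ← Real.mul_rpow (by norm_num) (by positivity)]
        exact Real.rpow_le_rpow (by positivity) (by linarith) (by linarith)
      calc min D (4 * k * r) * p ≤ 4 * k * r * p := by gcongr; exact min_le_right _ _
        _ = 4 * (r * p * k) := by ring
        _ ≤ 4 * (ENNReal.ofReal (|(m : ℝ)| ^ σ) * k) := by gcongr
        _ ≤ 4 * angularEnergy σ m := by gcongr; exact le_angularEnergy h0 hm
        _ ≤ _ := le_add_self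
  · have hJ : angularEnergy σ m ≤ p * K := by
      rcases eq_or_ne m 0 with rfl | hm
      · have : angularEnergy σ 0 = 0 := by simp [angularEnergy, angularKernel]
        rw [this]; exact zero_le
      · refine (angularEnergy_le h0 hm).trans ?_
        rw [← hK]
        gcongr
        rw [hp, habs]
        exact ENNReal.ofReal_le_ofReal
          (Real.rpow_le_rpow (by positivity) (by linarith) (by linarith))
    calc D + 4 * angularEnergy σ m ≤ D * p + 4 * (p * K) := by
          gcongr
          exact le_mul_of_one_le_right' hp1
      _ = _ := by ring

open FourierTransform in
/-- Half of Plancherel's theorem for improper Fourier transforms, by Fatou's lemma. -/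
theorem lintegral_enorm_sq_le_of_isImpFT {f F : ℝ → ℂ} (hf : Continuous f)
    (hF : ∀ ξ, ξ ≠ 0 → IsImpFT f ξ (F ξ)) :
    ∫⁻ ξ, ‖F ξ‖ₑ ^ 2 ≤ ∫⁻ x, ‖f x‖ₑ ^ 2 := by
  set t : ℕ → ℝ → ℂ := fun n => (Ioc (-(n : ℝ)) n).indicator f with ht
  have hi : ∀ n, Integrable (t n) := fun n =>
    (integrable_indicator_iff measurableSet_Ioc).2
      (hf.continuousOn.integrableOn_Icc.mono_set Ioc_subset_Icc_self)
  have h2 : ∀ n, MemLp (t n) 2 := fun n => by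
    rw [ht, memLp_indicator_iff_restrict measurableSet_Ioc,
      memLp_two_iff_integrable_sq_norm hf.aestronglyMeasurable.restrict]
    exact ((hf.norm.pow 2).continuousOn.integrableOn_Icc.mono_set Ioc_subset_Icc_self)
  have hlim : ∀ ξ, ξ ≠ 0 → Tendsto (fun n => 𝓕 (t n) ξ) atTop (nhds (F ξ)) := fun ξ hξ => by
    refine ((hF ξ hξ).comp tendsto_natCast_atTop_atTop).congr fun n => ?_
    rw [Real.fourier_real_eq_integral_exp_smul, Function.comp_apply,
      ← integral_indicator measurableSet_Ioc]
    congr 1; ext x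
    simp only [ht, smul_eq_mul, indicator_apply, mul_ite, mul_zero]
    split_ifs
    · rw [mul_comm]
      congr 2
      push_cast; ring
    · rfl
  calc ∫⁻ ξ, ‖F ξ‖ₑ ^ 2 = ∫⁻ ξ, liminf (fun n => ‖𝓕 (t n) ξ‖ₑ ^ 2) atTop := by
        refine lintegral_congr_ae ?_
        filter_upwards [compl_mem_ae_iff.2 (measure_singleton (0 : ℝ))] with ξ hξ
        have := (ENNReal.continuous_pow 2).continuousAt.tendsto.comp (hlim ξ hξ).enorm
        exact this.liminf_eq.symm
    _ ≤ liminf (fun n => ∫⁻ ξ, ‖𝓕 (t n) ξ‖ₑ ^ 2) atTop :=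
        lintegral_liminf_le fun n =>
          (continuous_fourier_of_integrable (hi n)).enorm.measurable.pow_const 2
    _ ≤ ∫⁻ x, ‖f x‖ₑ ^ 2 := by
        refine liminf_le_of_frequently_le' (Frequently.of_forall fun n => ?_)
        rw [lintegral_enorm_fourier_sq (hi n) (h2 n)]
        refine lintegral_mono fun x => ?_
        gcongr
        exact enorm_indicator_le_enorm_self _ _

theorem complNorm_zero (m : ℤ) :
    complNorm 0 m = ∫⁻ ξ, ‖derivFT (vEvenDeriv 0 m) ξ‖ₑ ^ 2 := by
  simp [complNorm]

/-- Two-sided bounds for the norms at `u = 0`. -/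
theorem exists_complNorm_zero_bounds :
    ∃ L U : ℝ≥0∞, 0 < L ∧ U < ⊤ ∧ ∀ m : ℤ, L ≤ complNorm 0 m ∧ complNorm 0 m ≤ U := by
  have hu : (-1 : ℝ) < 0 := by norm_num
  set δ := (2 : ℝ) ^ (-(1 + (0 : ℝ)) / 2) - 101 ^ (-(1 + (0 : ℝ)) / 2) with hδ
  refine ⟨ENNReal.ofReal δ ^ 2 / 4, ∫⁻ x : ℝ, ENNReal.ofReal ((1 + x ^ 2) ^ (-2 / 2 : ℝ)),
    ?_, ?_, fun m => ⟨?_, ?_⟩⟩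
  · have : 0 < ENNReal.ofReal δ := ENNReal.ofReal_pos.2 (sub_rpow_pos hu)
    exact ENNReal.div_pos (by positivity) (by norm_num)
  · exact (integrable_one_add_sq_rpow (r := 2) (by norm_num)).lintegral_lt_top
  · rw [complNorm_zero]
    refine ENNReal.div_le_of_le_mul' ?_
    rw [← lintegral_const_mul' _ _ (by norm_num)]
    calc ENNReal.ofReal δ ^ 2 = ∫⁻ _ in Ioc (0 : ℝ) 1, ENNReal.ofReal δ ^ 2 := by
          rw [setLIntegral_const, Real.volume_Ioc]; norm_num
      _ ≤ ∫⁻ x in Ioc (0 : ℝ) 1,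
          ‖vEven ((0 : ℝ) : ℂ) m (x + 10) - vEven ((0 : ℝ) : ℂ) m x‖ₑ ^ 2 := by
          refine setLIntegral_mono' measurableSet_Ioc fun x hx => pow_le_pow_left' ?_ 2
          rw [← ofReal_norm]
          exact ENNReal.ofReal_le_ofReal
            (sub_rpow_le_norm_vEven_sub hu m hx.1.le hx.2 (by linarith [hx.1]))
      _ ≤ ∫⁻ x, ‖vEven ((0 : ℝ) : ℂ) m (x + 10) - vEven ((0 : ℝ) : ℂ) m x‖ₑ ^ 2 :=
          setLIntegral_le_lintegral _ _
      _ = ∫⁻ ξ, ‖cexp (2 * π * I * (ξ * 10 : ℝ)) - 1‖ₑ ^ 2 *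
          ‖derivFT (vEvenDeriv 0 m) ξ‖ₑ ^ 2 :=
          lintegral_enorm_translate_sub_sq (hasDerivAt_vEven 0 m) (integrable_vEvenDeriv hu m)
            (norm_vEven_le_one hu m) 10
      _ ≤ ∫⁻ ξ, 4 * ‖derivFT (vEvenDeriv 0 m) ξ‖ₑ ^ 2 := by
          refine lintegral_mono fun ξ => ?_
          gcongr
          have h4 : (4 : ℝ≥0∞) = ENNReal.ofReal 2 ^ 2 := by norm_num
          rw [h4, ← ofReal_norm, norm_exp_two_pi_sub_one]
          gcongr
          linarith [Real.abs_sin_le_one (π * (ξ * 10))]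
  · rw [complNorm_zero]
    have hc : Continuous (vEven ((0 : ℝ) : ℂ) m) :=
      continuous_iff_continuousAt.2 fun x => (hasDerivAt_vEven 0 m x).continuousAt
    refine (lintegral_enorm_sq_le_of_isImpFT hc fun ξ hξ => isImpFT_vEven hu m hξ).trans
      (le_of_eq (lintegral_congr fun x => ?_))
    have hx : 0 < 1 + x ^ 2 := by positivity
    rw [← ofReal_norm, ← ENNReal.ofReal_pow (norm_nonneg _), norm_vEven, ← Real.rpow_two,
      ← Real.rpow_mul hx.le]
    congr 2; ring

theorem exists_complNorm_bounds {u : ℝ} (hu : u ∈ Ioc (-1 : ℝ) 0) :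
    ∃ L U : ℝ≥0∞, 0 < L ∧ U < ⊤ ∧ ∀ m : ℤ,
      L * ENNReal.ofReal ((1 + (m : ℝ) ^ 2) ^ (-u / 2)) ≤ complNorm u m ∧
      complNorm u m ≤ U * ENNReal.ofReal ((1 + (m : ℝ) ^ 2) ^ (-u / 2)) := by
  rcases hu.2.eq_or_lt with rfl | h
  · simpa using exists_complNorm_zero_bounds
  · have := exists_complNorm_bounds_of_neg (σ := -u) (by linarith) (by linarith [hu.1])
    rwa [neg_neg] at this

/-- for `u ∈ (−1,0]` the improper Fourier transforms of the K-type vectors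
`v_{2m}^{(u)}` exist away from `0`, and the complementary norms
`∫ |ξ|^{−u} |𝓕v_{2m}^{(u)}(ξ)|² dξ` are comparable to `(1+m²)^{−u/2}`, uniformly in `m`. -/
theorem stmt13 (u : ℝ) (hu : u ∈ Set.Ioc (-1 : ℝ) 0) :
    ∃ q' q : ℝ, 0 < q' ∧ 0 < q ∧
      ∀ m : ℤ, ∃ F : ℝ → ℂ,
        (∀ ξ : ℝ, ξ ≠ 0 → IsImpFT (vEven (u : ℂ) m) ξ (F ξ)) ∧
        ENNReal.ofReal (q' * (1 + (m : ℝ) ^ 2) ^ (-u / 2)) ≤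
          (∫⁻ ξ : ℝ, ENNReal.ofReal (|ξ| ^ (-u)) * (‖F ξ‖₊ : ℝ≥0∞) ^ 2) ∧
        (∫⁻ ξ : ℝ, ENNReal.ofReal (|ξ| ^ (-u)) * (‖F ξ‖₊ : ℝ≥0∞) ^ 2) ≤
          ENNReal.ofReal (q * (1 + (m : ℝ) ^ 2) ^ (-u / 2)) := by
  obtain ⟨L, U, hL, hU, h⟩ := exists_complNorm_bounds hu
  have hLU : L ≤ complNorm u 0 ∧ complNorm u 0 ≤ U := by simpa using h 0
  have hLt : L ≠ ⊤ := ((hLU.1.trans hLU.2).trans_lt hU).ne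
  have hU0 : U ≠ 0 := (hL.trans_le (hLU.1.trans hLU.2)).ne'
  refine ⟨L.toReal, U.toReal, ENNReal.toReal_pos hL.ne' hLt, ENNReal.toReal_pos hU0 hU.ne,
    fun m => ⟨derivFT (vEvenDeriv u m), fun ξ hξ => isImpFT_vEven hu.1 m hξ, ?_, ?_⟩⟩
  · rw [ENNReal.ofReal_mul ENNReal.toReal_nonneg, ENNReal.ofReal_toReal hLt]
    exact (h m).1
  · rw [ENNReal.ofReal_mul ENNReal.toReal_nonneg, ENNReal.ofReal_toReal hU.ne]
    exact (h m).2
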